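/- arXiv:2605.00235 — 10 statements merged into one kernel-verified Lean document; each statement's English description precedes it below -/
import Mathlib

section
/- Let τ̂, τ̄ : T → ℂ be nowhere-vanishing functions such that (i) both τ̂ and τ̄ satisfy the KP Hirota–Miwa equation, and (ii) for every t ∈ T and all nonzero pairwise distinct complex a₁, a₂, a₃ the bilinear Schwarzian-KP relation a₁₂(τ̂^{12}τ̄^3 + τ̂^3τ̄^{12}) + a₂₃(τ̂^{23}τ̄^1 + τ̂^1τ̄^{23}) + a₃₁(τ̂^{13}τ̄^2 + τ̂^2τ̄^{13}) = 0 holds. Then the function S := τ̄/τ̂ satisfies the discrete Schwarzian KP equation: for every t ∈ T and all nonzero pairwise distinct a₁, a₂, a₃, (S^1 − S^{12})(S^2 − S^{23})(S^3 − S^{13}) = (S^3 − S^{23})(S^1 − S^{13})(S^2 − S^{12}), where S^i = S(t − [aᵢ⁻¹]) and S^{ij} = S(t − [aᵢ⁻¹] − [aⱼ⁻¹]). -/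
noncomputable section

/-- The backward Miwa shift `t - [a⁻¹]`: the `k`-th entry (indexed from 0,
representing `t_{k+1}`) is `t_{k+1} - a^{-(k+1)}/(k+1)`. -/
def mshift (t : ℕ → ℂ) (a : ℂ) : ℕ → ℂ :=
  fun k => t k - (a ^ (k + 1))⁻¹ / (k + 1)

/-- A function `τ` on the space of sequences satisfies the KP Hirota–Miwa
equation. -/
def KPHM (τ : (ℕ → ℂ) → ℂ) : Prop :=
  ∀ t : ℕ → ℂ, ∀ a₁ a₂ a₃ : ℂ, a₁ ≠ 0 → a₂ ≠ 0 → a₃ ≠ 0 →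
    (a₁ - a₂) * τ (mshift (mshift t a₁) a₂) * τ (mshift t a₃)
    + (a₂ - a₃) * τ (mshift (mshift t a₂) a₃) * τ (mshift t a₁)
    + (a₃ - a₁) * τ (mshift (mshift t a₁) a₃) * τ (mshift t a₂) = 0

/-- If the quadratics `(z - A₁)(z - A₂)`, `(z - B₁)(z - B₂)`, `(z - C₁)(z - C₂)` are linearly
dependent, with a nonzero coefficient on the first, then their root pairs are in involution. -/
lemma involution_of_quadratic_dependence {K : Type*} [Field K] {X Y Z A₁ A₂ B₁ B₂ C₁ C₂ : K}
    (hX : X ≠ 0) (h0 : X + Y + Z = 0)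
    (h1 : X * (A₂ + A₁) + Y * (B₂ + B₁) + Z * (C₂ + C₁) = 0)
    (h2 : X * (A₂ * A₁) + Y * (B₂ * B₁) + Z * (C₂ * C₁) = 0) :
    (A₁ - C₂) * (B₁ - A₂) * (C₁ - B₂) = (C₁ - A₂) * (A₁ - B₂) * (B₁ - C₂) := by
  refine mul_left_cancel₀ hX ?_
  linear_combination
    -(((B₂ + B₁) * (C₂ * C₁) - (C₂ + C₁) * (B₂ * B₁)) * h0 - (C₂ * C₁ - B₂ * B₁) * h1
      + (C₂ + C₁ - B₂ - B₁) * h2)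

/-- if `τ̂, τ̄` are nowhere vanishing KP tau-functions connected by the
bilinear Schwarzian-KP relation, then `S = τ̄/τ̂` satisfies the discrete
Schwarzian KP equation. -/
theorem discrete_SchKP_of_bilinear
    (τh τb : (ℕ → ℂ) → ℂ)
    (hτh : ∀ t, τh t ≠ 0) (hτb : ∀ t, τb t ≠ 0)
    (hKPh : KPHM τh) (hKPb : KPHM τb)
    (hbil : ∀ t : ℕ → ℂ, ∀ a₁ a₂ a₃ : ℂ, a₁ ≠ 0 → a₂ ≠ 0 → a₃ ≠ 0 →
      a₁ ≠ a₂ → a₂ ≠ a₃ → a₁ ≠ a₃ →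
      (a₁ - a₂) * (τh (mshift (mshift t a₁) a₂) * τb (mshift t a₃)
        + τh (mshift t a₃) * τb (mshift (mshift t a₁) a₂))
      + (a₂ - a₃) * (τh (mshift (mshift t a₂) a₃) * τb (mshift t a₁)
        + τh (mshift t a₁) * τb (mshift (mshift t a₂) a₃))
      + (a₃ - a₁) * (τh (mshift (mshift t a₁) a₃) * τb (mshift t a₂)
        + τh (mshift t a₂) * τb (mshift (mshift t a₁) a₃)) = 0)
    (S : (ℕ → ℂ) → ℂ) (hS : ∀ u, S u = τb u / τh u) :
    ∀ t : ℕ → ℂ, ∀ a₁ a₂ a₃ : ℂ, a₁ ≠ 0 → a₂ ≠ 0 → a₃ ≠ 0 →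
      a₁ ≠ a₂ → a₂ ≠ a₃ → a₁ ≠ a₃ →
      (S (mshift t a₁) - S (mshift (mshift t a₁) a₂))
        * (S (mshift t a₂) - S (mshift (mshift t a₂) a₃))
        * (S (mshift t a₃) - S (mshift (mshift t a₁) a₃))
      = (S (mshift t a₃) - S (mshift (mshift t a₂) a₃))
        * (S (mshift t a₁) - S (mshift (mshift t a₁) a₃))
        * (S (mshift t a₂) - S (mshift (mshift t a₁) a₂)) := by
  intro t a₁ a₂ a₃ ha₁ ha₂ ha₃ h₁₂ h₂₃ h₁₃
  have hb : ∀ u, τb u = S u * τh u := fun u => by rw [hS, div_mul_cancel₀ _ (hτh u)]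
  have k0 := hKPh t a₁ a₂ a₃ ha₁ ha₂ ha₃
  have k1 := hbil t a₁ a₂ a₃ ha₁ ha₂ ha₃ h₁₂ h₂₃ h₁₃
  have k2 := hKPb t a₁ a₂ a₃ ha₁ ha₂ ha₃
  simp only [hb] at k1 k2
  refine involution_of_quadratic_dependence
    (X := (a₂ - a₃) * τh (mshift (mshift t a₂) a₃) * τh (mshift t a₁))
    (Y := (a₃ - a₁) * τh (mshift (mshift t a₁) a₃) * τh (mshift t a₂))
    (Z := (a₁ - a₂) * τh (mshift (mshift t a₁) a₂) * τh (mshift t a₃))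
    (mul_ne_zero (mul_ne_zero (sub_ne_zero.mpr h₂₃) (hτh _)) (hτh _)) ?_ ?_ ?_
  · linear_combination k0
  · linear_combination k1
  · linear_combination k2
end
end

section
/- Let a₁, a₂, a₃ be pairwise distinct complex numbers, let τ̂^1, τ̂^2, τ̂^3, τ̂^{12}, τ̂^{23}, τ̂^{13} be nonzero complex numbers, and let S^1, S^2, S^3, S^{12}, S^{23}, S^{13} be complex numbers. Assume the three relations (with a_{ij} = aᵢ − aⱼ): (i) a₁₂τ̂^{12}τ̂^3 + a₂₃τ̂^{23}τ̂^1 + a₃₁τ̂^{13}τ̂^2 = 0; (ii) a₁₂τ̂^{12}τ̂^3(S^3 + S^{12}) + a₂₃τ̂^{23}τ̂^1(S^1 + S^{23}) + a₃₁τ̂^{13}τ̂^2(S^2 + S^{13}) = 0; (iii) a₁₂τ̂^{12}τ̂^3 S^3 S^{12} + a₂₃τ̂^{23}τ̂^1 S^1 S^{23} + a₃₁τ̂^{13}τ̂^2 S^2 S^{13} = 0. Then (S^1 − S^{12})(S^2 − S^{23})(S^3 − S^{13}) = (S^3 − S^{23})(S^1 − S^{13})(S^2 − S^{12}). -/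
/-- If a linear combination, with nonzero leading coefficient, of the quadratics with roots
`{a, a'}`, `{b, b'}`, `{c, c'}` vanishes, then the three pairs are in involution. -/
theorem involution_of_linear_relation {R : Type*} [CommRing R] [IsDomain R]
    {x y z a a' b b' c c' : R} (hx : x ≠ 0)
    (h₀ : x + y + z = 0)
    (h₁ : x * (a + a') + y * (b + b') + z * (c + c') = 0)
    (h₂ : x * (a * a') + y * (b * b') + z * (c * c') = 0) :
    (a - c') * (b - a') * (c - b') = (c - a') * (a - b') * (b - c') := by
  apply mul_left_cancel₀ hx
  linear_combination -(((b + b') * (c * c') - (c + c') * (b * b')) * h₀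
    - (c * c' - b * b') * h₁ + ((c + c') - (b + b')) * h₂)

/-- from the KP Hirota–Miwa relation for `τ̂` and the two bilinear
relations (SS2), (SS2b) for `S`, the discrete Schwarzian KP equation follows. -/
theorem discrete_SchKP_of_three_relations
    (a₁ a₂ a₃ : ℂ) (hd₁₂ : a₁ ≠ a₂) (hd₂₃ : a₂ ≠ a₃) (hd₁₃ : a₁ ≠ a₃)
    (τh1 τh2 τh3 τh12 τh23 τh13 : ℂ)
    (hτh1 : τh1 ≠ 0) (hτh2 : τh2 ≠ 0) (hτh3 : τh3 ≠ 0)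
    (hτh12 : τh12 ≠ 0) (hτh23 : τh23 ≠ 0) (hτh13 : τh13 ≠ 0)
    (S1 S2 S3 S12 S23 S13 : ℂ)
    (hKP : (a₁ - a₂) * τh12 * τh3 + (a₂ - a₃) * τh23 * τh1
      + (a₃ - a₁) * τh13 * τh2 = 0)
    (hSS2 : (a₁ - a₂) * τh12 * τh3 * (S3 + S12)
      + (a₂ - a₃) * τh23 * τh1 * (S1 + S23)
      + (a₃ - a₁) * τh13 * τh2 * (S2 + S13) = 0)
    (hSS2b : (a₁ - a₂) * τh12 * τh3 * S3 * S12
      + (a₂ - a₃) * τh23 * τh1 * S1 * S23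
      + (a₃ - a₁) * τh13 * τh2 * S2 * S13 = 0) :
    (S1 - S12) * (S2 - S23) * (S3 - S13)
      = (S3 - S23) * (S1 - S13) * (S2 - S12) := by
  refine involution_of_linear_relation (x := (a₂ - a₃) * τh23 * τh1)
    (y := (a₃ - a₁) * τh13 * τh2) (z := (a₁ - a₂) * τh12 * τh3)
    (mul_ne_zero (mul_ne_zero (sub_ne_zero.mpr hd₂₃) hτh23) hτh1) ?_ ?_ ?_
  · linear_combination hKP
  · linear_combination hSS2
  · linear_combination hSS2b
end

section
/- Let τ, τ̂ : T → ℂ be nowhere-vanishing functions satisfying the mKP Hirota–Miwa equation: a₁τ^2τ̂^1 − a₂τ^1τ̂^2 = (a₁ − a₂)τ^{12}τ̂ for every t ∈ T and all nonzero complex a₁, a₂. Then both τ and τ̂ satisfy the KP Hirota–Miwa equation: a₁₂τ^{12}τ^3 + a₂₃τ^{23}τ^1 + a₃₁τ^{13}τ^2 = 0 and a₁₂τ̂^{12}τ̂^3 + a₂₃τ̂^{23}τ̂^1 + a₃₁τ̂^{13}τ̂^2 = 0, for every t ∈ T and all nonzero complex a₁, a₂, a₃. -/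
noncomputable section

/-- The pair `(τ, τ̂)` satisfies the mKP Hirota–Miwa equation. -/
def MKPHM (τ τh : (ℕ → ℂ) → ℂ) : Prop :=
  ∀ t : ℕ → ℂ, ∀ a₁ a₂ : ℂ, a₁ ≠ 0 → a₂ ≠ 0 →
    a₁ * τ (mshift t a₂) * τh (mshift t a₁)
      - a₂ * τ (mshift t a₁) * τh (mshift t a₂)
    = (a₁ - a₂) * τ (mshift (mshift t a₁) a₂) * τh t

/-- Backward Miwa shifts commute. -/
theorem mshift_comm (t : ℕ → ℂ) (a b : ℂ) :
    mshift (mshift t a) b = mshift (mshift t b) a := by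
  funext k
  simp only [mshift]
  ring

/-- if the nowhere-vanishing pair `(τ, τ̂)` satisfies the mKP
Hirota–Miwa equation, then both `τ` and `τ̂` satisfy the KP Hirota–Miwa
equation. -/
theorem KP_of_mKP
    (τ τh : (ℕ → ℂ) → ℂ)
    (hτ : ∀ t, τ t ≠ 0) (hτh : ∀ t, τh t ≠ 0)
    (hmKP : MKPHM τ τh) :
    KPHM τ ∧ KPHM τh := by
  refine ⟨fun t a₁ a₂ a₃ h₁ h₂ h₃ => mul_right_cancel₀ (hτh t) ?_,
    fun t a₁ a₂ a₃ h₁ h₂ h₃ =>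
      mul_right_cancel₀ (hτ (mshift (mshift (mshift t a₁) a₂) a₃)) ?_⟩
  · linear_combination -τ (mshift t a₃) * hmKP t a₁ a₂ h₁ h₂
      - τ (mshift t a₁) * hmKP t a₂ a₃ h₂ h₃
      + τ (mshift t a₂) * hmKP t a₁ a₃ h₁ h₃
  · have e₁₂ := hmKP (mshift t a₃) a₁ a₂ h₁ h₂
    have e₂₃ := hmKP (mshift t a₁) a₂ a₃ h₂ h₃
    have e₁₃ := hmKP (mshift t a₂) a₁ a₃ h₁ h₃
    rw [mshift_comm t a₃ a₁, mshift_comm t a₃ a₂, mshift_comm (mshift t a₁) a₃ a₂] at e₁₂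
    rw [mshift_comm t a₂ a₁] at e₁₃
    linear_combination -τh (mshift (mshift t a₁) a₂) * e₁₂
      - τh (mshift (mshift t a₂) a₃) * e₂₃
      + τh (mshift (mshift t a₁) a₃) * e₁₃
end
end

section
/- Let τ, τ̂, τ̄ : T → ℂ be nowhere-vanishing functions such that both pairs (τ, τ̂) and (τ, τ̄) satisfy the mKP Hirota–Miwa equation: a₁τ^2τ̂^1 − a₂τ^1τ̂^2 = (a₁ − a₂)τ^{12}τ̂ and a₁τ^2τ̄^1 − a₂τ^1τ̄^2 = (a₁ − a₂)τ^{12}τ̄ for every t ∈ T and all nonzero a₁, a₂. Then for every t ∈ T and all nonzero pairwise distinct complex a₁, a₂, a₃, the bilinear Schwarzian-KP relation holds: a₁₂(τ̂^{12}τ̄^3 + τ̂^3τ̄^{12}) + a₂₃(τ̂^{23}τ̄^1 + τ̂^1τ̄^{23}) + a₃₁(τ̂^{13}τ̄^2 + τ̂^2τ̄^{13}) = 0. -/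
noncomputable section

/-- if the nowhere-vanishing pairs `(τ, τ̂)` and `(τ, τ̄)` both
satisfy the mKP Hirota–Miwa equation, then `τ̂, τ̄` satisfy the bilinear
Schwarzian-KP relation. -/
theorem bilinear_SchKP_of_two_mKP
    (τ τh τb : (ℕ → ℂ) → ℂ)
    (hτ : ∀ t, τ t ≠ 0) (hτh : ∀ t, τh t ≠ 0) (hτb : ∀ t, τb t ≠ 0)
    (hmKPh : MKPHM τ τh) (hmKPb : MKPHM τ τb) :
    ∀ t : ℕ → ℂ, ∀ a₁ a₂ a₃ : ℂ, a₁ ≠ 0 → a₂ ≠ 0 → a₃ ≠ 0 →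
      a₁ ≠ a₂ → a₂ ≠ a₃ → a₁ ≠ a₃ →
      (a₁ - a₂) * (τh (mshift (mshift t a₁) a₂) * τb (mshift t a₃)
        + τh (mshift t a₃) * τb (mshift (mshift t a₁) a₂))
      + (a₂ - a₃) * (τh (mshift (mshift t a₂) a₃) * τb (mshift t a₁)
        + τh (mshift t a₁) * τb (mshift (mshift t a₂) a₃))
      + (a₃ - a₁) * (τh (mshift (mshift t a₁) a₃) * τb (mshift t a₂)
        + τh (mshift t a₂) * τb (mshift (mshift t a₁) a₃)) = 0 := by
  intro t a₁ a₂ a₃ h₁ h₂ h₃ _ _ _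
  have eh₃ := hmKPh (mshift t a₃) a₁ a₂ h₁ h₂
  have eb₃ := hmKPb (mshift t a₃) a₁ a₂ h₁ h₂
  have eh₁ := hmKPh (mshift t a₁) a₂ a₃ h₂ h₃
  have eb₁ := hmKPb (mshift t a₁) a₂ a₃ h₂ h₃
  have eh₂ := hmKPh (mshift t a₂) a₃ a₁ h₃ h₁
  have eb₂ := hmKPb (mshift t a₂) a₃ a₁ h₃ h₁
  rw [mshift_comm t a₃ a₁, mshift_comm t a₃ a₂, mshift_comm (mshift t a₁) a₃ a₂] at eh₃ eb₃
  rw [mshift_comm t a₂ a₁, mshift_comm (mshift t a₂) a₃ a₁, mshift_comm t a₂ a₁] at eh₂ eb₂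
  refine (mul_eq_zero.mp ?_).resolve_left (hτ (mshift (mshift (mshift t a₁) a₂) a₃))
  linear_combination
    -τb (mshift (mshift t a₁) a₂) * eh₃ - τh (mshift (mshift t a₁) a₂) * eb₃
      - τb (mshift (mshift t a₂) a₃) * eh₁ - τh (mshift (mshift t a₂) a₃) * eb₁
      - τb (mshift (mshift t a₁) a₃) * eh₂ - τh (mshift (mshift t a₁) a₃) * eb₂
end
end

section
/- Let τ : T → ℂ satisfy the forward KP Hirota–Miwa equation a₁₂τ₁₂τ₃ + a₂₃τ₂₃τ₁ + a₃₁τ₁₃τ₂ = 0 for every t ∈ T and all nonzero a₁, a₂, a₃, let τ̂ : T → ℂ, assume τ and τ̂ are nowhere vanishing, and assume the pair (τ, τ̂) satisfies the forward mKP Hirota–Miwa equation a₁τ₁τ̂₂ − a₂τ₂τ̂₁ = (a₁ − a₂)τ τ̂₁₂ for every t ∈ T and all nonzero a₁, a₂. Then φ := τ̂/τ satisfies the discrete mKP equation: for every t ∈ T and all nonzero a₁, a₂, a₃, (a₁φ₂ − a₂φ₁)/φ₁₂ + (a₂φ₃ − a₃φ₂)/φ₂₃ + (a₃φ₁ − a₁φ₃)/φ₁₃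 = 0. -/
noncomputable section

/-- The forward Miwa shift `t + [a⁻¹]`: the `k`-th entry (indexed from 0,
representing `t_{k+1}`) is `t_{k+1} + a^{-(k+1)}/(k+1)`. -/
def pshift (t : ℕ → ℂ) (a : ℂ) : ℕ → ℂ :=
  fun k => t k + (a ^ (k + 1))⁻¹ / (k + 1)

/-- A function `τ` satisfies the forward KP Hirota–Miwa equation. -/
def KPHMfwd (τ : (ℕ → ℂ) → ℂ) : Prop :=
  ∀ t : ℕ → ℂ, ∀ a₁ a₂ a₃ : ℂ, a₁ ≠ 0 → a₂ ≠ 0 → a₃ ≠ 0 →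
    (a₁ - a₂) * τ (pshift (pshift t a₁) a₂) * τ (pshift t a₃)
    + (a₂ - a₃) * τ (pshift (pshift t a₂) a₃) * τ (pshift t a₁)
    + (a₃ - a₁) * τ (pshift (pshift t a₁) a₃) * τ (pshift t a₂) = 0

/-- The pair `(τ, τ̂)` satisfies the forward mKP Hirota–Miwa equation. -/
def MKPHMfwd (τ τh : (ℕ → ℂ) → ℂ) : Prop :=
  ∀ t : ℕ → ℂ, ∀ a₁ a₂ : ℂ, a₁ ≠ 0 → a₂ ≠ 0 →
    a₁ * τ (pshift t a₁) * τh (pshift t a₂)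
      - a₂ * τ (pshift t a₂) * τh (pshift t a₁)
    = (a₁ - a₂) * τ t * τh (pshift (pshift t a₁) a₂)

/-- Each summand of the discrete mKP equation is a quotient of values of `τ` alone. -/
lemma discrete_mKP_summand_eq {τ τh φ : (ℕ → ℂ) → ℂ}
    (hτ : ∀ t, τ t ≠ 0) (hτh : ∀ t, τh t ≠ 0) (hmKP : MKPHMfwd τ τh)
    (hφ : ∀ u, φ u = τh u / τ u) (t : ℕ → ℂ) {a b : ℂ} (ha : a ≠ 0) (hb : b ≠ 0) :
    (a * φ (pshift t b) - b * φ (pshift t a)) / φ (pshift (pshift t a) b)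
      = (a - b) * τ t * τ (pshift (pshift t a) b) / (τ (pshift t a) * τ (pshift t b)) := by
  have h := hmKP t a b ha hb
  have hτa := hτ (pshift t a)
  have hτb := hτ (pshift t b)
  have hτab := hτ (pshift (pshift t a) b)
  have hτhab := hτh (pshift (pshift t a) b)
  simp only [hφ]
  field_simp
  linear_combination h

/-- `φ = τ̂/τ` satisfies the discrete mKP equation. -/
theorem discrete_mKP_of_wave_function
    (τ τh : (ℕ → ℂ) → ℂ)
    (hKP : KPHMfwd τ)
    (hτ : ∀ t, τ t ≠ 0) (hτh : ∀ t, τh t ≠ 0)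
    (hmKP : MKPHMfwd τ τh)
    (φ : (ℕ → ℂ) → ℂ) (hφ : ∀ u, φ u = τh u / τ u) :
    ∀ t : ℕ → ℂ, ∀ a₁ a₂ a₃ : ℂ, a₁ ≠ 0 → a₂ ≠ 0 → a₃ ≠ 0 →
      (a₁ * φ (pshift t a₂) - a₂ * φ (pshift t a₁)) / φ (pshift (pshift t a₁) a₂)
      + (a₂ * φ (pshift t a₃) - a₃ * φ (pshift t a₂)) / φ (pshift (pshift t a₂) a₃)
      + (a₃ * φ (pshift t a₁) - a₁ * φ (pshift t a₃)) / φ (pshift (pshift t a₁) a₃)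
      = 0 := by
  intro t a₁ a₂ a₃ h₁ h₂ h₃
  have e₁₂ := discrete_mKP_summand_eq hτ hτh hmKP hφ t h₁ h₂
  have e₂₃ := discrete_mKP_summand_eq hτ hτh hmKP hφ t h₂ h₃
  have e₁₃ := discrete_mKP_summand_eq hτ hτh hmKP hφ t h₁ h₃
  have e₃₁ : (a₃ * φ (pshift t a₁) - a₁ * φ (pshift t a₃)) / φ (pshift (pshift t a₁) a₃)
      = -((a₁ - a₃) * τ t * τ (pshift (pshift t a₁) a₃)
        / (τ (pshift t a₁) * τ (pshift t a₃))) := by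
    rw [← e₁₃, ← neg_div, neg_sub]
  have hτ₁ := hτ (pshift t a₁)
  have hτ₂ := hτ (pshift t a₂)
  have hτ₃ := hτ (pshift t a₃)
  rw [e₁₂, e₂₃, e₃₁]
  field_simp
  linear_combination τ t * hKP t a₁ a₂ a₃ h₁ h₂ h₃
end
end

section
/- Let τ : T → ℂ satisfy the forward KP Hirota–Miwa equation a₁₂τ₁₂τ₃ + a₂₃τ₂₃τ₁ + a₃₁τ₁₃τ₂ = 0 for every t ∈ T and all nonzero a₁, a₂, a₃, let τ̂ : T → ℂ, assume τ and τ̂ are nowhere vanishing, and assume the pair (τ, τ̂) satisfies the forward mKP Hirota–Miwa equation a₁τ₁τ̂₂ − a₂τ₂τ̂₁ = (a₁ − a₂)τ τ̂₁₂ for every t ∈ T and all nonzero a₁, a₂. Then the reciprocal φ* := τ/τ̂ of the wave function φ = τ̂/τ satisfies the adjoint discrete mKP equation: for every t ∈ T and all nonzero a₁, a₂, a₃, (a₂φ*₁₂ − a₃φ*₁₃)/φ*₁ + (a₃φ*₂₃ − a₁φ*₁₂)/φ*₂ + (a₁φ*₁₃ − a₂φ*₂₃)/φ*₃ = 0. 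-/
noncomputable section

/-- The mKP Hirota–Miwa equation eliminates `τ̂` from each pair of terms of the adjoint discrete
mKP equation that share a double shift of `φ* = τ/τ̂`. -/
theorem MKPHMfwd.div_shift_sub_div_shift {τ τh φs : (ℕ → ℂ) → ℂ}
    (hmKP : MKPHMfwd τ τh) (hτ : ∀ t, τ t ≠ 0) (hτh : ∀ t, τh t ≠ 0)
    (hφs : ∀ u, φs u = τ u / τh u) (t : ℕ → ℂ) {a b : ℂ} (ha : a ≠ 0) (hb : b ≠ 0) :
    a * φs (pshift (pshift t a) b) / φs (pshift t b)
        - b * φs (pshift (pshift t a) b) / φs (pshift t a)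
      = (a - b) * τ t * τ (pshift (pshift t a) b) / (τ (pshift t a) * τ (pshift t b)) := by
  have h := hmKP t a b ha hb
  have h₁ := hτ (pshift t a)
  have h₂ := hτ (pshift t b)
  have k₁ := hτh (pshift t a)
  have k₂ := hτh (pshift t b)
  have k₁₂ := hτh (pshift (pshift t a) b)
  simp only [hφs]
  field_simp
  linear_combination τ (pshift (pshift t a) b) * h

/-- `φ* = τ/τ̂` satisfies the adjoint discrete mKP equation. -/
theorem adjoint_discrete_mKP_of_wave_function
    (τ τh : (ℕ → ℂ) → ℂ)
    (hKP : KPHMfwd τ)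
    (hτ : ∀ t, τ t ≠ 0) (hτh : ∀ t, τh t ≠ 0)
    (hmKP : MKPHMfwd τ τh)
    (φs : (ℕ → ℂ) → ℂ) (hφs : ∀ u, φs u = τ u / τh u) :
    ∀ t : ℕ → ℂ, ∀ a₁ a₂ a₃ : ℂ, a₁ ≠ 0 → a₂ ≠ 0 → a₃ ≠ 0 →
      (a₂ * φs (pshift (pshift t a₁) a₂) - a₃ * φs (pshift (pshift t a₁) a₃))
          / φs (pshift t a₁)
      + (a₃ * φs (pshift (pshift t a₂) a₃) - a₁ * φs (pshift (pshift t a₁) a₂))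
          / φs (pshift t a₂)
      + (a₁ * φs (pshift (pshift t a₁) a₃) - a₂ * φs (pshift (pshift t a₂) a₃))
          / φs (pshift t a₃)
      = 0 := by
  intro t a₁ a₂ a₃ ha₁ ha₂ ha₃
  have e₁₂ := hmKP.div_shift_sub_div_shift hτ hτh hφs t ha₁ ha₂
  have e₂₃ := hmKP.div_shift_sub_div_shift hτ hτh hφs t ha₂ ha₃
  have e₁₃ := hmKP.div_shift_sub_div_shift hτ hτh hφs t ha₁ ha₃
  have h₁ := hτ (pshift t a₁)
  have h₂ := hτ (pshift t a₂)
  have h₃ := hτ (pshift t a₃)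
  have key :
      (a₁ - a₂) * τ t * τ (pshift (pshift t a₁) a₂) / (τ (pshift t a₁) * τ (pshift t a₂))
      + (a₂ - a₃) * τ t * τ (pshift (pshift t a₂) a₃) / (τ (pshift t a₂) * τ (pshift t a₃))
      - (a₁ - a₃) * τ t * τ (pshift (pshift t a₁) a₃) / (τ (pshift t a₁) * τ (pshift t a₃))
      = 0 := by
    field_simp
    linear_combination τ t * hKP t a₁ a₂ a₃ ha₁ ha₂ ha₃
  linear_combination e₁₃ - e₁₂ - e₂₃ - key
end
end

section
/- Let a₁, a₂, a₃ be nonzero complex numbers with a_{ij} = aᵢ − aⱼ, and let τ̂^1, τ̂^2, τ̂^3, τ̂^{12}, τ̂^{13}, τ̂^{23} and τ̄^1, τ̄^2, τ̄^3, τ̄^{12}, τ̄^{13}, τ̄^{23} be complex numbers. Let M be the 4×4 matrix with rows (0, a₁τ̂^{13}, −a₂τ̂^{23}, −a₁₂τ̂^3), (0, a₁τ̄^{13}, −a₂τ̄^{23}, −a₁₂τ̄^3), (−a₃τ̂^{13}, 0, a₂τ̂^{12}, −a₂₃τ̂^1), (−a₃τ̄^{13}, 0, a₂τ̄^{12}, −a₂₃τ̄^1).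 Set R = a₁₂(τ̂^{12}τ̄^3 + τ̂^3τ̄^{12}) + a₂₃(τ̂^{23}τ̄^1 + τ̂^1τ̄^{23}) + a₃₁(τ̂^{13}τ̄^2 + τ̂^2τ̄^{13}), Ĥ = a₁₂τ̂^{12}τ̂^3 + a₂₃τ̂^{23}τ̂^1 + a₃₁τ̂^{13}τ̂^2, and H̄ = a₁₂τ̄^{12}τ̄^3 + a₂₃τ̄^{23}τ̄^1 + a₃₁τ̄^{13}τ̄^2. Then det M = a₁a₂a₃·(τ̂^{13}τ̄^{13}R − (τ̂^{13})²H̄ − (τ̄^{13})²Ĥ); in particular this identity holds for all values of τ̂^2 and τ̄^2, since the right-hand side is independent of them. -/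
/-- the 4×4 determinant identity underlying the derivation of the
bilinear Schwarzian-KP relation. -/
theorem det_M13_identity
    (a₁ a₂ a₃ : ℂ) (ha₁ : a₁ ≠ 0) (ha₂ : a₂ ≠ 0) (ha₃ : a₃ ≠ 0)
    (th1 th2 th3 th12 th13 th23 : ℂ) (tb1 tb2 tb3 tb12 tb13 tb23 : ℂ) :
    Matrix.det !![(0 : ℂ), a₁ * th13, -(a₂ * th23), -((a₁ - a₂) * th3);
                  0, a₁ * tb13, -(a₂ * tb23), -((a₁ - a₂) * tb3);
                  -(a₃ * th13), 0, a₂ * th12, -((a₂ - a₃) * th1);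
                  -(a₃ * tb13), 0, a₂ * tb12, -((a₂ - a₃) * tb1)]
      = a₁ * a₂ * a₃ *
          (th13 * tb13 *
              ((a₁ - a₂) * (th12 * tb3 + th3 * tb12)
                + (a₂ - a₃) * (th23 * tb1 + th1 * tb23)
                + (a₃ - a₁) * (th13 * tb2 + th2 * tb13))
            - th13 ^ 2 *
              ((a₁ - a₂) * tb12 * tb3 + (a₂ - a₃) * tb23 * tb1
                + (a₃ - a₁) * tb13 * tb2)
            - tb13 ^ 2 *
              ((a₁ - a₂) * th12 * th3 + (a₂ - a₃) * th23 * th1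
                + (a₃ - a₁) * th13 * th2)) := by
  simp [Matrix.det_succ_row_zero, Fin.sum_univ_succ, Fin.succAbove]
  ring
end

section
/- Fix an integer m ≥ 2 and let τ : T → ℂ. For a fixed t ∈ T and nonzero complex numbers c₁, …, c_r define the bracket τ[c₁, …, c_r] := (∏_{1 ≤ i < j ≤ r} (cᵢ − cⱼ)) · τ(t − [c₁⁻¹] − ⋯ − [c_r⁻¹]). Suppose that for every t ∈ T and all nonzero complex numbers c₁, …, c_{m+2} and d₁, …, d_m one has Σ_{k=1}^{m+2} (−1)^{k−1} τ[c₁, …, ĉ_k, …, c_{m+2}] · τ[c_k, d₁, …, d_m] = 0 (the hat means the entry c_k is omitted). Then for every t ∈ T, all nonzero complex a₁, …, a_{m+1}, b₁, …, b_{m−1}, and all nonzero z, ζ: Σ_{k=1}^{m+1} (−1)^{k−1} ( τ[a₁, …, â_k, …, a_{m+1}, z] · τ[a_k, b₁, …, b_{m−1}, ζ] + τ[a₁, …, â_k, …, a_{m+1}, ζ] · τ[a_k, b₁, …, b_{m−1}, z] ) = 0. -/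
noncomputable section

open Finset

/-- The iterated backward Miwa shift `t - [c₁⁻¹] - ⋯ - [c_r⁻¹]`: the `k`-th
entry (indexed from 0, representing `t_{k+1}`) is
`t_{k+1} - Σᵢ cᵢ^{-(k+1)}/(k+1)`. -/
def msum (t : ℕ → ℂ) {r : ℕ} (c : Fin r → ℂ) : ℕ → ℂ :=
  fun k => t k - ∑ i : Fin r, (c i ^ (k + 1))⁻¹ / (k + 1)

/-- The Vandermonde product `∏_{i<j} (cᵢ - cⱼ)`. -/
def vprod {r : ℕ} (c : Fin r → ℂ) : ℂ :=
  ∏ i : Fin r, ∏ j ∈ Finset.Ioi i, (c i - c j)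

/-- The bracket `τ[c₁, …, c_r] = (∏_{i<j}(cᵢ - cⱼ)) · τ(t - [c₁⁻¹] - ⋯ - [c_r⁻¹])`. -/
def bracket (τ : (ℕ → ℂ) → ℂ) (t : ℕ → ℂ) {r : ℕ} (c : Fin r → ℂ) : ℂ :=
  vprod c * τ (msum t c)

theorem vprod_comp_perm {r : ℕ} (c : Fin r → ℂ) (σ : Equiv.Perm (Fin r)) :
    vprod (c ∘ σ) = (Equiv.Perm.sign σ : ℤ) * vprod c := by
  have vprod_eq_det (v : Fin r → ℂ) : vprod v = (Matrix.vandermonde (-v)).det := by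
    simp [vprod, Matrix.det_vandermonde, neg_add_eq_sub]
  rw [vprod_eq_det, vprod_eq_det, ← Matrix.det_permute]
  rfl

theorem msum_comp_perm (t : ℕ → ℂ) {r : ℕ} (c : Fin r → ℂ) (σ : Equiv.Perm (Fin r)) :
    msum t (c ∘ σ) = msum t c := by
  funext k
  simp only [msum, Function.comp_apply]
  rw [Equiv.sum_comp σ fun i => (c i ^ (k + 1))⁻¹ / ((k : ℂ) + 1)]

theorem bracket_comp_perm (τ : (ℕ → ℂ) → ℂ) (t : ℕ → ℂ) {r : ℕ} (c : Fin r → ℂ)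
    (σ : Equiv.Perm (Fin r)) :
    bracket τ t (c ∘ σ) = (Equiv.Perm.sign σ : ℤ) * bracket τ t c := by
  rw [bracket, bracket, vprod_comp_perm, msum_comp_perm, mul_assoc]

theorem snoc_cons_comp_swap {α : Type*} {n : ℕ} (b : Fin n → α) (x y : α) :
    (Fin.snoc (Fin.cons x b : Fin (n + 1) → α) y : Fin (n + 2) → α)
        ∘ Equiv.swap 0 (Fin.last (n + 1))
      = Fin.snoc (Fin.cons y b : Fin (n + 1) → α) x := by
  rw [← Fin.cons_snoc_eq_snoc_cons, ← Fin.cons_snoc_eq_snoc_cons]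
  funext i
  refine Fin.cases ?_ (fun j => ?_) i
  · simp [← Fin.succ_last]
  · refine Fin.lastCases ?_ (fun l => ?_) j
    · simp
    · rw [Function.comp_apply, Equiv.swap_apply_of_ne_of_ne (Fin.succ_ne_zero _)]
      · simp
      · simp [← Fin.succ_last, Fin.castSucc_ne_last]

/-- Exchanging the first and last entries changes the sign of a bracket. -/
theorem bracket_swap_ends (τ : (ℕ → ℂ) → ℂ) (t : ℕ → ℂ) {n : ℕ} (b : Fin n → ℂ) (x y : ℂ) :
    bracket τ t (Fin.snoc (Fin.cons y b : Fin (n + 1) → ℂ) x : Fin (n + 2) → ℂ)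
      = -bracket τ t (Fin.snoc (Fin.cons x b : Fin (n + 1) → ℂ) y : Fin (n + 2) → ℂ) := by
  rw [← snoc_cons_comp_swap, bracket_comp_perm, Equiv.Perm.sign_swap (Fin.last_pos).ne]
  simp

theorem snoc_comp_castSucc_succAbove {α : Type*} {n : ℕ} (a : Fin (n + 1) → α) (z : α)
    (k : Fin (n + 1)) :
    (Fin.snoc a z : Fin (n + 2) → α) ∘ k.castSucc.succAbove
      = (Fin.snoc (a ∘ k.succAbove) z : Fin (n + 1) → α) := by
  funext i
  refine Fin.lastCases ?_ (fun j => ?_) i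
  · simp [Fin.castSucc_ne_last]
  · simp

theorem snoc_ne_zero {n : ℕ} {a : Fin n → ℂ} {z : ℂ} (ha : ∀ i, a i ≠ 0) (hz : z ≠ 0)
    (i : Fin (n + 1)) : (Fin.snoc a z : Fin (n + 1) → ℂ) i ≠ 0 := by
  refine Fin.lastCases ?_ (fun j => ?_) i
  · simpa using hz
  · simpa using ha j

/-- the Plücker-type Miwa form of the KP hierarchy implies its
symmetrized version, the combinatorial core of the bilinear Schwarzian-KP
equation. -/
theorem symmetrized_Plucker
    (m : ℕ) (hm : 2 ≤ m) (τ : (ℕ → ℂ) → ℂ)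
    (hPl : ∀ t : ℕ → ℂ, ∀ c : Fin (m + 2) → ℂ, ∀ d : Fin m → ℂ,
      (∀ i, c i ≠ 0) → (∀ i, d i ≠ 0) →
      ∑ k : Fin (m + 2), (-1 : ℂ) ^ (k : ℕ)
        * bracket τ t (c ∘ k.succAbove) * bracket τ t (Fin.cons (c k) d) = 0) :
    ∀ t : ℕ → ℂ, ∀ a : Fin (m + 1) → ℂ, ∀ b : Fin (m - 1) → ℂ, ∀ z ζ : ℂ,
      (∀ i, a i ≠ 0) → (∀ i, b i ≠ 0) → z ≠ 0 → ζ ≠ 0 →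
      ∑ k : Fin (m + 1), (-1 : ℂ) ^ (k : ℕ)
        * (bracket τ t (Fin.snoc (a ∘ k.succAbove) z)
              * bracket τ t (Fin.snoc (Fin.cons (a k) b) ζ)
            + bracket τ t (Fin.snoc (a ∘ k.succAbove) ζ)
              * bracket τ t (Fin.snoc (Fin.cons (a k) b) z)) = 0 := by
  intro t a b z ζ ha hb hz hζ
  obtain ⟨n, rfl⟩ : ∃ n, m = n + 1 := ⟨m - 1, by omega⟩
  change Fin n → ℂ at b
  have key (x y : ℂ) (hx : x ≠ 0) (hy : y ≠ 0) :
      ∑ k : Fin (n + 2), (-1 : ℂ) ^ (k : ℕ)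
          * (bracket τ t (Fin.snoc (a ∘ k.succAbove) x : Fin (n + 2) → ℂ)
            * bracket τ t (Fin.snoc (Fin.cons (a k) b : Fin (n + 1) → ℂ) y : Fin (n + 2) → ℂ))
        + (-1 : ℂ) ^ (n + 2) * (bracket τ t a
            * bracket τ t (Fin.snoc (Fin.cons x b : Fin (n + 1) → ℂ) y : Fin (n + 2) → ℂ))
        = 0 := by
    have h := hPl t (Fin.snoc a x) (Fin.snoc b y) (snoc_ne_zero ha hx) (snoc_ne_zero hb hy)
    have snoc_comp_last : (Fin.snoc a x : Fin (n + 3) → ℂ) ∘ (Fin.last (n + 2)).succAbove = a := by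
      funext i
      simp
    rw [Fin.sum_univ_castSucc] at h
    simpa only [snoc_comp_castSucc_succAbove, snoc_comp_last, Fin.snoc_castSucc, Fin.snoc_last,
      Fin.cons_snoc_eq_snoc_cons, Fin.val_castSucc, Fin.val_last, mul_assoc] using h
  have h₁ := key z ζ hz hζ
  have h₂ := key ζ z hζ hz
  rw [bracket_swap_ends τ t b z ζ] at h₂
  simp only [mul_add, sum_add_distrib]
  linear_combination h₁ + h₂
end
end

section
/- Let h : T × (ℂ \ {0}) → ℂ be a function that is nowhere vanishing and satisfies, for every t ∈ T and all nonzero complex numbers a, b, the relation h(t − [a⁻¹], b) · h(t, a) = h(t − [b⁻¹], a) · h(t, b). Then there exists a nowhere-vanishing function H : T → ℂ such that h(t, a) = H(t − [a⁻¹]) / H(t) for every t ∈ T and every nonzero complex a. -/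
noncomputable section

open scoped IsMulCommutative in
/-- A multiplicative cocycle for translations by a `ℤ`-linearly independent family is a
coboundary: the corresponding skew translations of `T × M` commute, hence define an action of
the free abelian group on the family, whose orbits give the potential. -/
theorem exists_potential_of_linearIndependent {ι T M : Type*} [AddCommGroup T] [CommGroup M]
    {v : ι → T} (hv : LinearIndependent ℤ v) (h : T → ι → M)
    (hh : ∀ t i j, h (t + v i) j * h t i = h (t + v j) i * h t j) :
    ∃ H : T → M, ∀ t i, H (t + v i) = h t i * H t := by
  let e : ι → Equiv.Perm (T × M) := fun i =>
    { toFun := fun p => (p.1 + v i, h p.1 i * p.2)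
      invFun := fun p => (p.1 - v i, (h (p.1 - v i) i)⁻¹ * p.2)
      left_inv := fun p => by simp
      right_inv := fun p => by simp }
  have he : ∀ i p, e i p = (p.1 + v i, h p.1 i * p.2) := fun _ _ => rfl
  have hcomm : ∀ x ∈ Set.range e, ∀ y ∈ Set.range e, x * y = y * x := by
    rintro _ ⟨i, rfl⟩ _ ⟨j, rfl⟩
    ext1 p
    simp only [Equiv.Perm.mul_apply, he]
    rw [add_right_comm, ← mul_assoc, ← mul_assoc, hh]
  have := Subgroup.isMulCommutative_closure hcomm
  let E : ι → Subgroup.closure (Set.range e) := fun i =>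
    ⟨e i, Subgroup.subset_closure ⟨i, rfl⟩⟩
  let φ : (ι →₀ ℤ) →+ Additive (Subgroup.closure (Set.range e)) :=
    Finsupp.liftAddHom fun i => zmultiplesHom _ (Additive.ofMul (E i))
  let Φ : (ι →₀ ℤ) → Equiv.Perm (T × M) := fun n => (φ n).toMul
  have hΦ_zero : Φ 0 = 1 := by simp [Φ]
  have hΦ_add : ∀ m n, Φ (m + n) = Φ m * Φ n := fun m n => by simp [Φ]
  have hΦ_single : ∀ i, Φ (Finsupp.single i 1) = e i := fun i => by simp [Φ, φ, E]
  have hΦ_fst : ∀ n p, (Φ n p).1 = p.1 + Finsupp.linearCombination ℤ v n := by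
    intro n
    induction n using Finsupp.induction_linear with
    | zero => simp [hΦ_zero]
    | add m n hm hn => intro p; simp [hΦ_add, hm, hn, add_comm, add_left_comm]
    | single i k =>
      induction k using Int.induction_on with
      | zero => simp [hΦ_zero]
      | succ k hk =>
        intro p
        rw [Finsupp.single_add, hΦ_add, Equiv.Perm.mul_apply, hk, hΦ_single, he, map_add]
        simp [add_comm, add_assoc]
      | pred k hk =>
        intro p
        have hs := hk ((e i).symm p)
        have hp : Φ (Finsupp.single i (-(k : ℤ) - 1)) p =
            Φ (Finsupp.single i (-(k : ℤ))) ((e i).symm p) := by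
          have hsplit : Finsupp.single i (-(k : ℤ)) =
              Finsupp.single i (-(k : ℤ) - 1) + Finsupp.single i 1 := by
            rw [← Finsupp.single_add, sub_add_cancel]
          rw [hsplit, hΦ_add, Equiv.Perm.mul_apply, hΦ_single, Equiv.apply_symm_apply]
        have hfst : ((e i).symm p).1 = p.1 - v i := rfl
        rw [hp, hs, hfst]
        simp only [Finsupp.linearCombination_single, sub_smul, one_smul]
        abel
  let L : AddSubgroup T := (Finsupp.linearCombination ℤ v).toAddMonoidHom.range
  let r : T → T := fun t => Quotient.out (t : T ⧸ L)
  have hr : ∀ t, ∃ n, r t + Finsupp.linearCombination ℤ v n = t := fun t => by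
    obtain ⟨n, hn⟩ : -r t + t ∈ L := QuotientAddGroup.eq.mp (Quotient.out_eq (t : T ⧸ L))
    exact ⟨n, by rw [← LinearMap.toAddMonoidHom_coe, hn, add_neg_cancel_left]⟩
  choose n hn using hr
  have hr_add : ∀ t i, r (t + v i) = r t := fun t i => by
    have : ((t + v i : T) : T ⧸ L) = t := by
      rw [eq_comm, QuotientAddGroup.eq]
      exact ⟨Finsupp.single i 1, by simp⟩
    simp only [r, this]
  have hn_add : ∀ t i, n (t + v i) = Finsupp.single i 1 + n t := fun t i => by
    apply hv
    have h₁ := hn (t + v i)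
    rw [hr_add] at h₁
    apply add_left_cancel (a := r t)
    rw [h₁, map_add, add_left_comm, hn]
    simp [add_comm]
  refine ⟨fun t => (Φ (n t) (r t, 1)).2, fun t i => ?_⟩
  simp only [hr_add, hn_add, hΦ_add, hΦ_single, Equiv.Perm.mul_apply, he, hΦ_fst, hn]

theorem linearIndependent_geometric (K : Type*) [Field K] :
    LinearIndependent K fun (x : K) (k : ℕ) => x ^ k := by
  have hpow := (linearIndependent_monoidHom (Multiplicative ℕ) K).comp (powersHom K)
    (powersHom K).injective
  exact hpow

/-- The Miwa shift vectors `-[a⁻¹]` are `ℤ`-linearly independent. -/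
theorem linearIndependent_mshift_zero : LinearIndependent ℤ fun a : ℂˣ => mshift 0 a := by
  have hgeom : LinearIndependent ℂ fun (a : ℂˣ) (k : ℕ) => ((a⁻¹ : ℂˣ) : ℂ) ^ k :=
    (linearIndependent_geometric ℂ).comp (fun a : ℂˣ => ((a⁻¹ : ℂˣ) : ℂ))
      (Units.val_injective.comp inv_injective)
  have hscaled := hgeom.units_smul fun a => a⁻¹
  have hmshift : LinearIndependent ℂ fun a : ℂˣ => mshift 0 a := by
    refine LinearIndependent.of_comp (LinearMap.mulLeft ℂ fun k : ℕ => -((k : ℂ) + 1)) ?_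
    have heq : (LinearMap.mulLeft ℂ fun k : ℕ => -((k : ℂ) + 1)) ∘ (fun a : ℂˣ => mshift 0 a) =
        (fun a : ℂˣ => a⁻¹) • fun (a : ℂˣ) (k : ℕ) => ((a⁻¹ : ℂˣ) : ℂ) ^ k := by
      ext a k
      have hk : (k : ℂ) + 1 ≠ 0 := Nat.cast_add_one_ne_zero k
      simp only [Function.comp_apply, LinearMap.mulLeft_apply, Pi.mul_apply, mshift,
        Pi.zero_apply, Pi.smul_apply', Pi.smul_apply, Units.smul_def, smul_eq_mul,
        Units.val_inv_eq_inv_val, inv_pow]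
      field_simp
      ring
    exact heq ▸ hscaled
  exact hmshift.restrict_scalars' ℤ

/-- the potential-reconstruction lemma of
Date–Jimbo–Kashiwara–Miwa. If a nowhere-vanishing `h(t, a)` (defined for
nonzero `a`) satisfies the multiplicative compatibility condition
`h(t − [a⁻¹], b)·h(t, a) = h(t − [b⁻¹], a)·h(t, b)`, then there exists a
nowhere-vanishing potential `H` with `h(t, a) = H(t − [a⁻¹])/H(t)`. -/
theorem potential_reconstruction
    (h : (ℕ → ℂ) → ℂ → ℂ)
    (hne : ∀ t : ℕ → ℂ, ∀ a : ℂ, a ≠ 0 → h t a ≠ 0)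
    (hcocycle : ∀ t : ℕ → ℂ, ∀ a b : ℂ, a ≠ 0 → b ≠ 0 →
      h (mshift t a) b * h t a = h (mshift t b) a * h t b) :
    ∃ H : (ℕ → ℂ) → ℂ, (∀ t, H t ≠ 0) ∧
      ∀ t : ℕ → ℂ, ∀ a : ℂ, a ≠ 0 → h t a = H (mshift t a) / H t := by
  have hshift : ∀ (t : ℕ → ℂ) (a : ℂ), t + mshift 0 a = mshift t a := fun t a => by
    ext k
    simp [mshift, sub_eq_add_neg]
  obtain ⟨H, hH⟩ := exists_potential_of_linearIndependent linearIndependent_mshift_zero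
    (fun t (a : ℂˣ) => Units.mk0 (h t a) (hne t a a.ne_zero)) fun t a b => by
      ext
      simpa [hshift] using hcocycle t a b a.ne_zero b.ne_zero
  refine ⟨fun t => H t, fun t => (H t).ne_zero, fun t a ha => ?_⟩
  have hHa := congrArg Units.val (hH t (Units.mk0 a ha))
  simp only [Units.val_mk0, Units.val_mul, hshift] at hHa
  beta_reduce
  rw [hHa, mul_div_cancel_right₀ _ (H t).ne_zero]
end
end

section
/- Let a₁, a₂, a₃ be nonzero pairwise distinct complex numbers, let τ̂, τ̂^1, τ̂^2, τ̂^3, τ̂^{12}, τ̂^{23}, τ̂^{13} be nonzero complex numbers satisfying the KP relation a₁₂τ̂^{12}τ̂^3 + a₂₃τ̂^{23}τ̂^1 + a₃₁τ̂^{13}τ̂^2 = 0, and let S, S^1, S^2, S^3, S^{12}, S^{23}, S^{13} be complex numbers. Set Û^{αβ} = τ̂ τ̂^{αβ}/(τ̂^α τ̂^β) and Δ^{αβ}S = S^{αβ} + S − S^α − S^β. Then the relation a₁₂τ̂^{12}τ̂^3(S^3 + S^{12}) + a₂₃τ̂^{23}τ̂^1(S^1 + S^{23}) + a₃₁τ̂^{13}τ̂^2(S^2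 + S^{13}) = 0 holds if and only if a₁⁻¹(a₂⁻¹ − a₃⁻¹)Û^{23}Δ^{23}S + a₂⁻¹(a₃⁻¹ − a₁⁻¹)Û^{13}Δ^{13}S + a₃⁻¹(a₁⁻¹ − a₂⁻¹)Û^{12}Δ^{12}S = 0. -/
/-- equivalence of the linear equation (SS1) for `S` with its
rewriting (SS3) in terms of the face variables `Û^{αβ} = τ̂τ̂^{αβ}/(τ̂^ατ̂^β)`
and the second differences `Δ^{αβ}S = S^{αβ} + S − S^α − S^β`, given the KP
Hirota–Miwa relation for `τ̂`. -/
theorem SS1_iff_SS3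
    (a₁ a₂ a₃ : ℂ) (ha₁ : a₁ ≠ 0) (ha₂ : a₂ ≠ 0) (ha₃ : a₃ ≠ 0)
    (hd₁₂ : a₁ ≠ a₂) (hd₂₃ : a₂ ≠ a₃) (hd₁₃ : a₁ ≠ a₃)
    (th th1 th2 th3 th12 th23 th13 : ℂ)
    (hth : th ≠ 0) (hth1 : th1 ≠ 0) (hth2 : th2 ≠ 0) (hth3 : th3 ≠ 0)
    (hth12 : th12 ≠ 0) (hth23 : th23 ≠ 0) (hth13 : th13 ≠ 0)
    (hKP : (a₁ - a₂) * th12 * th3 + (a₂ - a₃) * th23 * th1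
      + (a₃ - a₁) * th13 * th2 = 0)
    (S S1 S2 S3 S12 S23 S13 : ℂ) :
    ((a₁ - a₂) * th12 * th3 * (S3 + S12)
      + (a₂ - a₃) * th23 * th1 * (S1 + S23)
      + (a₃ - a₁) * th13 * th2 * (S2 + S13) = 0)
    ↔ (a₁⁻¹ * (a₂⁻¹ - a₃⁻¹) * (th * th23 / (th2 * th3)) * (S23 + S - S2 - S3)
      + a₂⁻¹ * (a₃⁻¹ - a₁⁻¹) * (th * th13 / (th1 * th3)) * (S13 + S - S1 - S3)
      + a₃⁻¹ * (a₁⁻¹ - a₂⁻¹) * (th * th12 / (th1 * th2)) * (S12 + S - S1 - S2)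
      = 0) := by
  have key : a₁⁻¹ * (a₂⁻¹ - a₃⁻¹) * (th * th23 / (th2 * th3)) * (S23 + S - S2 - S3)
      + a₂⁻¹ * (a₃⁻¹ - a₁⁻¹) * (th * th13 / (th1 * th3)) * (S13 + S - S1 - S3)
      + a₃⁻¹ * (a₁⁻¹ - a₂⁻¹) * (th * th12 / (th1 * th2)) * (S12 + S - S1 - S2)
      = -(th / (a₁ * a₂ * a₃ * th1 * th2 * th3)) *
        (((a₁ - a₂) * th12 * th3 * (S3 + S12)
          + (a₂ - a₃) * th23 * th1 * (S1 + S23)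
          + (a₃ - a₁) * th13 * th2 * (S2 + S13))
        + (S - S1 - S2 - S3) * ((a₁ - a₂) * th12 * th3 + (a₂ - a₃) * th23 * th1
          + (a₃ - a₁) * th13 * th2)) := by
    field_simp
    ring
  have hfactor : -(th / (a₁ * a₂ * a₃ * th1 * th2 * th3)) ≠ 0 := by
    simp [*]
  rw [key, hKP, mul_zero, add_zero, mul_eq_zero, or_iff_right hfactor]
end
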